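/- Let d : ℕ → ℝ be a binary digit sequence (d i ∈ {0,1} for all i) and n ≥ 1. Let w n denote the non-standard vector representation of the first n digits: the vector in EuclideanSpace ℝ (Fin (2^n − 1)) obtained by concatenating n blocks, where the k-th block (k = 1, …, n) consists of 2^(n−k) coordinates all equal to d (k−1). Then ‖w n‖ = √(x*), where x* = ∑_{k=1}^{n} d (k−1) · 2^(n−k) is the integer representative of the digit string. -/

import Mathlib

open Real Filter

/-- The first `k` blocks, of lengths `2 ^ (n - 1), …, 2 ^ (n - k)`, together with a block of
length `2 ^ (n - k)`, have total length `2 ^ n`. -/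
lemma sum_Icc_two_pow_sub_add (n k : ℕ) (hk : k ≤ n) :
    (∑ m ∈ Finset.Icc 1 k, 2 ^ (n - m)) + 2 ^ (n - k) = 2 ^ n := by
  induction k with
  | zero => simp
  | succ k ih =>
    rw [Finset.sum_Icc_succ_top (by lia), ← ih (by lia), show n - k = n - (k + 1) + 1 by lia,
      pow_succ]
    ring

/-- If `f` takes the constant value `c k` on the `k`-th of consecutive blocks of lengths
`l 1, l 2, …`, then its sum over the first `n` blocks is `∑ c k * l k`. -/
lemma sum_range_of_eq_on_blocks {R : Type*} [CommSemiring R] (f c : ℕ → R) (l : ℕ → ℕ) (n : ℕ)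
    (h : ∀ k, 1 ≤ k → k ≤ n → ∀ j, (∑ m ∈ Finset.Icc 1 (k - 1), l m) ≤ j →
      j < ∑ m ∈ Finset.Icc 1 k, l m → f j = c k) :
    ∑ j ∈ Finset.range (∑ m ∈ Finset.Icc 1 n, l m), f j =
      ∑ k ∈ Finset.Icc 1 n, c k * (l k : R) := by
  induction n with
  | zero => simp
  | succ n ih =>
    have hS := Finset.sum_Icc_succ_top (Nat.le_add_left 1 n) l
    have hlast : ∀ i ∈ Finset.range (l (n + 1)),
        f ((∑ m ∈ Finset.Icc 1 n, l m) + i) = c (n + 1) := by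
      intro i hi
      rw [Finset.mem_range] at hi
      exact h (n + 1) (by lia) le_rfl _ (by simp) (by lia)
    rw [hS, Finset.sum_range_add, ih fun k hk hkn => h k hk (by lia),
      Finset.sum_congr rfl hlast, Finset.sum_Icc_succ_top (by lia)]
    simp [mul_comm]

/-- The non-standard vector representation of the first `n` digits of `d` is the vector
`w n ∈ ℝ^(2^n - 1)` obtained by concatenating, for `k = 1, …, n`, a block of `2^(n-k)`
coordinates all equal to `d (k-1)`: block `k` occupies the positions `j` with
`∑_{m=1}^{k-1} 2^(n-m) ≤ j < ∑_{m=1}^{k} 2^(n-m)`.  Its norm is `√(x*)`, where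
`x* = ∑_{k=1}^{n} d (k-1) · 2^(n-k)` is the integer representative of the digit string. -/
theorem stmt_3 (d : ℕ → ℝ) (hd : ∀ i, d i = 0 ∨ d i = 1) (n : ℕ) (hn : 1 ≤ n)
    (w : EuclideanSpace ℝ (Fin (2 ^ n - 1)))
    (hw : ∀ k, 1 ≤ k → k ≤ n → ∀ j : Fin (2 ^ n - 1),
      (∑ m ∈ Finset.Icc 1 (k - 1), 2 ^ (n - m)) ≤ (j : ℕ) →
      (j : ℕ) < ∑ m ∈ Finset.Icc 1 k, 2 ^ (n - m) →
      w j = d (k - 1)) :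
    ‖w‖ = Real.sqrt (∑ k ∈ Finset.Icc 1 n, d (k - 1) * 2 ^ (n - k)) := by
  have hlen : ∑ m ∈ Finset.Icc 1 n, 2 ^ (n - m) = 2 ^ n - 1 := by
    have := sum_Icc_two_pow_sub_add n n le_rfl
    simp only [Nat.sub_self, pow_zero] at this
    lia
  let f : ℕ → ℝ := fun j => if h : j < 2 ^ n - 1 then w ⟨j, h⟩ ^ 2 else 0
  have hf : ∀ k, 1 ≤ k → k ≤ n → ∀ j, (∑ m ∈ Finset.Icc 1 (k - 1), 2 ^ (n - m)) ≤ j →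
      j < ∑ m ∈ Finset.Icc 1 k, 2 ^ (n - m) → f j = d (k - 1) := by
    intro k hk hkn j hj hj'
    have hle : ∑ m ∈ Finset.Icc 1 k, 2 ^ (n - m) ≤ ∑ m ∈ Finset.Icc 1 n, 2 ^ (n - m) :=
      Finset.sum_le_sum_of_subset (Finset.Icc_subset_Icc_right hkn)
    have hjn : j < 2 ^ n - 1 := hlen ▸ hj'.trans_le hle
    simp only [f, dif_pos hjn, hw k hk hkn ⟨j, hjn⟩ hj hj']
    rcases hd (k - 1) with h | h <;> simp [h]
  have hsum := sum_range_of_eq_on_blocks f (fun k => d (k - 1)) (fun m => 2 ^ (n - m)) n hf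
  rw [hlen, ← Fin.sum_univ_eq_sum_range] at hsum
  push_cast at hsum
  rw [EuclideanSpace.norm_eq, ← hsum]
  simp [f]
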